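/- Let Δ₀, Δ₁, …, Δ_s be a sequence of Delzant polygons in ℝ² such that, for each i, the polygon Δᵢ is obtained from Δᵢ₋₁ by a corner chopping of size δᵢ > 0, and let 0 ≤ j ≤ s. Then for every edge d of Δ_j, the image of d in ℤ[edges of Δ_s] under the composition of the s − j injection homomorphisms is a linear combination Σ_{i=0}^{ℓ} mᵢ·cᵢ, where c₀, …, c_ℓ are distinct edges of Δ_s whose union is a connected subset of ℝ², ℓ ≤ s − j, and each coefficient mᵢ is a non-negative integer satisfying mᵢ ≤ 2^{s−j}. -/

import Mathlib

open Set Finset MeasureTheory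

/-- Points of ℝⁿ. -/
abbrev Pt (n : ℕ) := Fin n → ℝ

/-- A convex polytope in ℝⁿ: a compact convex set with nonempty interior and
finitely many extreme points. -/
def IsConvexPolytope {n : ℕ} (Δ : Set (Pt n)) : Prop :=
  IsCompact Δ ∧ Convex ℝ Δ ∧ (interior Δ).Nonempty ∧ (Set.extremePoints ℝ Δ).Finite

/-- An edge (one-dimensional face) of a polytope: a nondegenerate closed segment
that is an extreme subset of the polytope. -/
def IsEdge {n : ℕ} (Δ e : Set (Pt n)) : Prop :=
  (∃ a b : Pt n, a ≠ b ∧ e = segment ℝ a b) ∧ IsExtreme ℝ Δ e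

/-- A family of vectors of ℝⁿ forming a basis of the lattice ℤⁿ. -/
def IsLatticeBasis {n : ℕ} (α : Fin n → Pt n) : Prop :=
  ∃ A : Matrix (Fin n) (Fin n) ℤ, IsUnit A.det ∧ ∀ j i, α j i = (A j i : ℝ)

/-- The Delzant condition at the vertex `v`: the edges emanating from `v` have the
form `{v + s • α j : 0 ≤ s ≤ ℓ j}` where the `α j` form a basis of the lattice ℤⁿ. -/
def DelzantAt {n : ℕ} (Δ : Set (Pt n)) (v : Pt n) : Prop :=
  ∃ (α : Fin n → Pt n) (ℓ : Fin n → ℝ), IsLatticeBasis α ∧ (∀ j, 0 < ℓ j) ∧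
    {e | IsEdge Δ e ∧ v ∈ e} = {e | ∃ j, e = segment ℝ v (v + ℓ j • α j)}

/-- A Delzant polytope in ℝⁿ. -/
def IsDelzant {n : ℕ} (Δ : Set (Pt n)) : Prop :=
  IsConvexPolytope Δ ∧ ∀ v ∈ Set.extremePoints ℝ Δ, DelzantAt Δ v

/-- `Δ'` is obtained from `Δ` by a corner chopping of size `δ` at the vertex `v`. -/
def IsCornerChop {n : ℕ} (Δ : Set (Pt n)) (v : Pt n) (δ : ℝ) (Δ' : Set (Pt n)) : Prop :=
  v ∈ Set.extremePoints ℝ Δ ∧ 0 < δ ∧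
  ∃ (α : Fin n → Pt n) (ℓ : Fin n → ℝ), IsLatticeBasis α ∧ (∀ j, δ < ℓ j) ∧
    {e | IsEdge Δ e ∧ v ∈ e} = {e | ∃ j, e = segment ℝ v (v + ℓ j • α j)} ∧
    Δ' = Δ ∩ {x | ∃ s : Fin n → ℝ, x = v + ∑ j, s j • α j ∧ δ ≤ ∑ j, s j}

/-- An element of AGL(n,ℤ): an affine map `x ↦ A x + c` with `A ∈ GL(n,ℤ)`. -/
def IsAGL {n : ℕ} (g : Pt n → Pt n) : Prop :=
  ∃ (A : Matrix (Fin n) (Fin n) ℤ) (c : Pt n), IsUnit A.det ∧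
    ∀ x, g x = (A.map (fun z : ℤ => (z : ℝ))).mulVec x + c

/-- Two subsets of ℝⁿ are AGL(n,ℤ)-congruent. -/
def AGLCongruent {n : ℕ} (S T : Set (Pt n)) : Prop :=
  ∃ g : Pt n → Pt n, IsAGL g ∧ g '' S = T

/-- A primitive vector of ℤⁿ: nonzero and not a multiple `m • w` with `m ≥ 2`. -/
def IsPrimitive {n : ℕ} (v : Fin n → ℤ) : Prop :=
  v ≠ 0 ∧ ∀ m : ℕ, 2 ≤ m → ∀ w : Fin n → ℤ, v ≠ (m : ℤ) • w

/-- `d` is a segment of rational slope and rational length `ℓ`: its endpoints differ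
by `ℓ • v` with `v` a primitive vector of ℤⁿ. -/
def RatLength {n : ℕ} (d : Set (Pt n)) (ℓ : ℝ) : Prop :=
  0 < ℓ ∧ ∃ (a : Pt n) (v : Fin n → ℤ), IsPrimitive v ∧
    d = segment ℝ a (a + ℓ • fun i => (v i : ℝ))

/-- `P` is the (rational) perimeter of the polygon `Δ`: the sum of the rational
lengths of its edges. -/
def HasPerimeter (Δ : Set (Pt 2)) (P : ℝ) : Prop :=
  ∃ (E : Finset (Set (Pt 2))) (len : Set (Pt 2) → ℝ),
    (↑E = {e | IsEdge Δ e}) ∧ (∀ e ∈ E, RatLength e (len e)) ∧ P = ∑ e ∈ E, len e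

/-- The Delzant triangle of size `lam`. -/
def DelzantTriangle (lam : ℝ) : Set (Pt 2) :=
  {x | 0 ≤ x 0 ∧ 0 ≤ x 1 ∧ x 0 + x 1 ≤ lam}

/-- The Hirzebruch trapezoid with parameters `a`, `b`, `k`. -/
def Hirz (a b : ℝ) (k : ℕ) : Set (Pt 2) :=
  {x | -(b/2) ≤ x 1 ∧ x 1 ≤ b/2 ∧ 0 ≤ x 0 ∧ x 0 ≤ a - k * x 1}

/-- `u` is an outward normal vector of the edge `e` of the polygon `Δ`. -/
def OutwardNormal (Δ e : Set (Pt 2)) (u : Pt 2) : Prop :=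
  u ≠ 0 ∧ ∃ c : ℝ, (∀ x ∈ e, ∑ i, u i * x i = c) ∧ ∀ x ∈ Δ, ∑ i, u i * x i ≤ c

/-- The edge `e` of `Δ` and the edge `e'` of `Δ'` have the same outward normal vector. -/
def SameOutwardNormal (Δ e Δ' e' : Set (Pt 2)) : Prop :=
  ∃ u : Pt 2, OutwardNormal Δ e u ∧ OutwardNormal Δ' e' u

/-- Extension of a map on edges to the free abelian group `ℤ[edges]`, realized as
finitely supported functions. -/
noncomputable def extendF (f : Set (Pt 2) → (Set (Pt 2) →₀ ℤ))
    (g : Set (Pt 2) →₀ ℤ) : Set (Pt 2) →₀ ℤ :=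
  g.sum fun e m => m • f e

/-- `iterChain f j k g` applies the homomorphisms extending `f j, f (j+1), …,
f (j+k-1)`, in this order, to `g`. -/
noncomputable def iterChain (f : ℕ → Set (Pt 2) → (Set (Pt 2) →₀ ℤ)) :
    ℕ → ℕ → (Set (Pt 2) →₀ ℤ) → (Set (Pt 2) →₀ ℤ)
  | _, 0, g => g
  | j, k + 1, g => iterChain f (j + 1) k (extendF (f j) g)

/-- `f` (restricted to edges of `Δ`) is the injection homomorphism
`ℤ[edges of Δ] → ℤ[edges of Δ']` associated to a corner chopping at the vertex `v`
creating the new edge `newE`: an edge `d` of `Δ` not containing `v` is sent to the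
edge of `Δ'` with the same outward normal vector, and an edge `d` containing `v` is
sent to `d' + newE` where `d'` is the edge of `Δ'` with the same outward normal. -/
def IsInjectionHom (Δ Δ' newE : Set (Pt 2)) (v : Pt 2)
    (f : Set (Pt 2) → (Set (Pt 2) →₀ ℤ)) : Prop :=
  ∀ d, IsEdge Δ d →
    ((v ∉ d → ∃ d', IsEdge Δ' d' ∧ SameOutwardNormal Δ d Δ' d' ∧
        f d = Finsupp.single d' 1) ∧
     (v ∈ d → ∃ d', IsEdge Δ' d' ∧ SameOutwardNormal Δ d Δ' d' ∧
        f d = Finsupp.single d' 1 + Finsupp.single newE 1))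

/-- A point of `Δ` on the line spanned by an extreme segment lies on the segment. -/
lemma mem_segment_of_isExtreme {Δ : Set (Pt 2)} {a b : Pt 2}
    (h : IsExtreme ℝ Δ (segment ℝ a b)) {t : ℝ} (hx : a + t • (b - a) ∈ Δ) :
    a + t • (b - a) ∈ segment ℝ a b := by
  have ha := left_mem_segment ℝ a b
  have hb := right_mem_segment ℝ a b
  rcases lt_or_ge t 0 with h0 | h0
  · refine h.left_mem_of_mem_openSegment hx (h.subset hb) ha ?_
    have h1 : 0 < 1 - t := by linarith
    refine ⟨1 / (1 - t), -t / (1 - t), by positivity, div_pos (by linarith) h1, by field_simp; ring, ?_⟩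
    ext i
    simp only [Pi.add_apply, Pi.smul_apply, Pi.sub_apply, smul_eq_mul]
    field_simp
    ring
  rcases lt_or_ge 1 t with h1 | h1
  · refine h.right_mem_of_mem_openSegment (h.subset ha) hx hb ?_
    have h2 : 0 < t := by linarith
    refine ⟨1 - 1 / t, 1 / t, ?_, by positivity, by ring, ?_⟩
    · rw [sub_pos, div_lt_one h2]; exact h1
    ext i
    simp only [Pi.add_apply, Pi.smul_apply, Pi.sub_apply, smul_eq_mul]
    field_simp
    ring
  · exact ⟨1 - t, t, by linarith, h0, by ring, by
      ext i
      simp only [Pi.add_apply, Pi.smul_apply, Pi.sub_apply, smul_eq_mul]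
      ring⟩

/-- An edge contained in a line contains every point of the polygon on that line. -/
lemma IsEdge.mem_of_line {Δ d : Set (Pt 2)} (hd : IsEdge Δ d) {u : Pt 2} (hu : u ≠ 0) {c : ℝ}
    (hc : ∀ x ∈ d, ∑ i, u i * x i = c) {x : Pt 2} (hx : x ∈ Δ) (hxc : ∑ i, u i * x i = c) :
    x ∈ d := by
  obtain ⟨⟨a, b, hab, rfl⟩, hext⟩ := hd
  have ha := hc a (left_mem_segment ℝ a b)
  have hb := hc b (right_mem_segment ℝ a b)
  simp only [Fin.sum_univ_two] at ha hb hxc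
  have hcross : (x 0 - a 0) * (b 1 - a 1) = (x 1 - a 1) * (b 0 - a 0) := by
    by_cases h0 : u 0 = 0
    · have h1 : u 1 ≠ 0 := fun h1 => hu (by ext i; fin_cases i <;> assumption)
      apply mul_left_cancel₀ h1
      simp only [h0] at ha hb hxc
      linear_combination (x 0 - a 0) * (hb - ha) - (b 0 - a 0) * (hxc - ha)
    · apply mul_left_cancel₀ h0
      linear_combination (b 1 - a 1) * (hxc - ha) - (x 1 - a 1) * (hb - ha)
  obtain ⟨t, rfl⟩ : ∃ t : ℝ, x = a + t • (b - a) := by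
    by_cases h0 : b 0 - a 0 = 0
    · have h1 : b 1 - a 1 ≠ 0 := fun h1 => hab (by
        ext i; fin_cases i
        · exact (sub_eq_zero.1 h0).symm
        · exact (sub_eq_zero.1 h1).symm)
      have h2 : x 0 - a 0 = 0 := by
        rw [h0, mul_zero] at hcross
        exact (mul_eq_zero.1 hcross).resolve_right h1
      refine ⟨(x 1 - a 1) / (b 1 - a 1), ?_⟩
      ext i; fin_cases i
      · simp [h0]; linarith
      · simp [div_mul_cancel₀ _ h1]
    · refine ⟨(x 0 - a 0) / (b 0 - a 0), ?_⟩
      ext i; fin_cases i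
      · simp [div_mul_cancel₀ _ h0]
      · simp; field_simp; linarith
  exact mem_segment_of_isExtreme hext hx

/-- The midpoint of two distinct points of a segment lies in the open segment. -/
lemma midpoint_mem_openSegment_of_mem {a b x y : Pt 2} (hx : x ∈ segment ℝ a b)
    (hy : y ∈ segment ℝ a b) (hxy : x ≠ y) : midpoint ℝ x y ∈ openSegment ℝ a b := by
  obtain ⟨r, s, hr, hs, hrs, rfl⟩ := hx
  obtain ⟨r', s', hr', hs', hrs', rfl⟩ := hy
  have hne : r ≠ r' := by
    rintro rfl
    obtain rfl : s = s' := by linarith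
    exact hxy rfl
  have hne' : s ≠ s' := fun h => hne (by linarith)
  refine ⟨(r + r') / 2, (s + s') / 2, ?_, ?_, by linarith, ?_⟩
  · rcases hne.lt_or_gt with h | h <;> linarith
  · rcases hne'.lt_or_gt with h | h <;> linarith
  · rw [midpoint_eq_smul_add]
    ext i
    simp only [Pi.add_apply, Pi.smul_apply, smul_eq_mul, invOf_eq_inv]
    ring

lemma IsEdge.convex {Δ d : Set (Pt 2)} (hd : IsEdge Δ d) : Convex ℝ d := by
  obtain ⟨⟨a, b, -, rfl⟩, -⟩ := hd
  exact convex_segment a b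

lemma IsEdge.subset_of_two_mem {Δ d e : Set (Pt 2)} (hd : IsEdge Δ d) (he : IsEdge Δ e)
    {x y : Pt 2} (hxy : x ≠ y) (hx : x ∈ d ∩ e) (hy : y ∈ d ∩ e) : d ⊆ e := by
  have hm : midpoint ℝ x y ∈ e := he.convex.midpoint_mem hx.2 hy.2
  obtain ⟨⟨a, b, -, rfl⟩, hext⟩ := hd
  have hm' := midpoint_mem_openSegment_of_mem hx.1 hy.1 hxy
  have ha := hext.subset (left_mem_segment ℝ a b)
  have hb := hext.subset (right_mem_segment ℝ a b)
  exact he.convex.segment_subset (he.2.left_mem_of_mem_openSegment ha hb hm hm')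
    (he.2.right_mem_of_mem_openSegment ha hb hm hm')

/-- Edges sharing two distinct points coincide. -/
lemma IsEdge.eq_of_two_mem {Δ d e : Set (Pt 2)} (hd : IsEdge Δ d) (he : IsEdge Δ e)
    {x y : Pt 2} (hxy : x ≠ y) (hx : x ∈ d ∩ e) (hy : y ∈ d ∩ e) : d = e :=
  (hd.subset_of_two_mem he hxy hx hy).antisymm (he.subset_of_two_mem hd hxy hx.symm hy.symm)

/-- `p`, `q` are the affine coordinates with origin `v` and basis `α₁`, `α₂`. -/
structure IsAffineCoords (v α₁ α₂ : Pt 2) (p q : Pt 2 → ℝ) : Prop where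
  repr : ∀ x, v + p x • α₁ + q x • α₂ = x
  fst : ∀ s t : ℝ, p (v + s • α₁ + t • α₂) = s
  snd : ∀ s t : ℝ, q (v + s • α₁ + t • α₂) = t
  fst_comb : ∀ (a b : ℝ) (x y : Pt 2), a + b = 1 → p (a • x + b • y) = a * p x + b * p y
  snd_comb : ∀ (a b : ℝ) (x y : Pt 2), a + b = 1 → q (a • x + b • y) = a * q x + b * q y
  fst_cont : Continuous p
  snd_cont : Continuous q

lemma exists_isAffineCoords (v : Pt 2) {α₁ α₂ : Pt 2} (h : IsLatticeBasis ![α₁, α₂]) :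
    ∃ p q, IsAffineCoords v α₁ α₂ p q := by
  obtain ⟨A, hA, hα⟩ := h
  have hD : α₁ 0 * α₂ 1 - α₁ 1 * α₂ 0 ≠ 0 := by
    have h1 := hα 0 0
    have h2 := hα 0 1
    have h3 := hα 1 0
    have h4 := hα 1 1
    simp only [Matrix.cons_val_zero, Matrix.cons_val_one] at h1 h2 h3 h4
    rw [h1, h2, h3, h4]
    have := hA.ne_zero
    rw [Matrix.det_fin_two] at this
    exact_mod_cast this
  set D := α₁ 0 * α₂ 1 - α₁ 1 * α₂ 0 with hDdef
  refine ⟨fun x => ((x 0 - v 0) * α₂ 1 - (x 1 - v 1) * α₂ 0) / D,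
    fun x => (α₁ 0 * (x 1 - v 1) - α₁ 1 * (x 0 - v 0)) / D, ?_, ?_, ?_, ?_, ?_, ?_, ?_⟩
  · intro x
    ext i
    fin_cases i <;>
    · simp only [Pi.add_apply, Pi.smul_apply, smul_eq_mul, Fin.zero_eta, Fin.mk_one]
      field_simp
      rw [hDdef]
      ring
  · intro s t
    rw [div_eq_iff hD, hDdef]
    simp only [Pi.add_apply, Pi.smul_apply, smul_eq_mul]
    ring
  · intro s t
    rw [div_eq_iff hD, hDdef]
    simp only [Pi.add_apply, Pi.smul_apply, smul_eq_mul]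
    ring
  · intro a b x y hab
    obtain rfl : b = 1 - a := by linarith
    simp only [Pi.add_apply, Pi.smul_apply, smul_eq_mul]
    field_simp
    ring
  · intro a b x y hab
    obtain rfl : b = 1 - a := by linarith
    simp only [Pi.add_apply, Pi.smul_apply, smul_eq_mul]
    field_simp
    ring
  · fun_prop
  · fun_prop

lemma IsAffineCoords.swap {v α₁ α₂ : Pt 2} {p q : Pt 2 → ℝ} (h : IsAffineCoords v α₁ α₂ p q) :
    IsAffineCoords v α₂ α₁ q p where
  repr x := by rw [add_right_comm]; exact h.repr x
  fst s t := by rw [add_right_comm]; exact h.snd t s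
  snd s t := by rw [add_right_comm]; exact h.fst t s
  fst_comb := h.snd_comb
  snd_comb := h.fst_comb
  fst_cont := h.snd_cont
  snd_cont := h.fst_cont

/-- The data of a corner chopping, expressed in the affine coordinates at the vertex. -/
structure IsChop (Δ Δ' : Set (Pt 2)) (v α₁ α₂ : Pt 2) (δ ℓ₁ ℓ₂ : ℝ) (p q : Pt 2 → ℝ) :
    Prop where
  coords : IsAffineCoords v α₁ α₂ p q
  convex : Convex ℝ Δ
  pos : 0 < δ
  lt_fst : δ < ℓ₁
  lt_snd : δ < ℓ₂
  edge_fst : IsEdge Δ (segment ℝ v (v + ℓ₁ • α₁))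
  edge_snd : IsEdge Δ (segment ℝ v (v + ℓ₂ • α₂))
  eq_or_eq : ∀ d, IsEdge Δ d → v ∈ d →
    d = segment ℝ v (v + ℓ₁ • α₁) ∨ d = segment ℝ v (v + ℓ₂ • α₂)
  mem_iff : ∀ x, x ∈ Δ' ↔ x ∈ Δ ∧ δ ≤ p x + q x

namespace IsChop

variable {Δ Δ' : Set (Pt 2)} {v α₁ α₂ : Pt 2} {δ ℓ₁ ℓ₂ : ℝ} {p q : Pt 2 → ℝ}

lemma swap (h : IsChop Δ Δ' v α₁ α₂ δ ℓ₁ ℓ₂ p q) : IsChop Δ Δ' v α₂ α₁ δ ℓ₂ ℓ₁ q p where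
  coords := h.coords.swap
  convex := h.convex
  pos := h.pos
  lt_fst := h.lt_snd
  lt_snd := h.lt_fst
  edge_fst := h.edge_snd
  edge_snd := h.edge_fst
  eq_or_eq d hd hv := (h.eq_or_eq d hd hv).symm
  mem_iff x := by rw [add_comm]; exact h.mem_iff x

lemma coords_vertex (h : IsChop Δ Δ' v α₁ α₂ δ ℓ₁ ℓ₂ p q) : p v = 0 ∧ q v = 0 := by
  have h1 := h.coords.fst 0 0
  have h2 := h.coords.snd 0 0
  simp only [zero_smul, add_zero] at h1 h2
  exact ⟨h1, h2⟩

lemma coords_axis (h : IsChop Δ Δ' v α₁ α₂ δ ℓ₁ ℓ₂ p q) (t : ℝ) :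
    p (v + t • α₁) = t ∧ q (v + t • α₁) = 0 := by
  have h1 := h.coords.fst t 0
  have h2 := h.coords.snd t 0
  simp only [zero_smul, add_zero] at h1 h2
  exact ⟨h1, h2⟩

lemma snd_eq_zero_of_mem_edge (h : IsChop Δ Δ' v α₁ α₂ δ ℓ₁ ℓ₂ p q) {x : Pt 2}
    (hx : x ∈ segment ℝ v (v + ℓ₁ • α₁)) : q x = 0 := by
  obtain ⟨a, b, -, -, hab, rfl⟩ := hx
  rw [h.coords.snd_comb _ _ _ _ hab, h.coords_vertex.2, (h.coords_axis ℓ₁).2]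
  ring

lemma snd_nonneg (h : IsChop Δ Δ' v α₁ α₂ δ ℓ₁ ℓ₂ p q) {x : Pt 2} (hx : x ∈ Δ) : 0 ≤ q x := by
  by_contra! hneg
  have hℓ₁ : 0 < ℓ₁ := h.pos.trans h.lt_fst
  have hℓ₂ : 0 < ℓ₂ := h.pos.trans h.lt_snd
  have hy : v + ℓ₂ • α₂ ∈ Δ := h.edge_snd.2.subset (right_mem_segment ℝ _ _)
  have hpos : 0 < ℓ₂ - q x := by linarith
  have ha : 0 < ℓ₂ / (ℓ₂ - q x) := by positivity
  have hb : 0 < -q x / (ℓ₂ - q x) := div_pos (by linarith) hpos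
  have hab : ℓ₂ / (ℓ₂ - q x) + -q x / (ℓ₂ - q x) = 1 := by field_simp; ring
  set a := ℓ₂ / (ℓ₂ - q x) with ha'
  set b := -q x / (ℓ₂ - q x) with hb'
  set z := a • x + b • (v + ℓ₂ • α₂) with hz
  have hzΔ : z ∈ Δ := h.convex hx hy ha.le hb.le hab
  have hqz : q z = 0 := by
    rw [hz, h.coords.snd_comb _ _ _ _ hab, (h.swap.coords_axis ℓ₂).1, ha', hb']
    field_simp
    ring
  have hzeq : z = v + (p z / ℓ₁) • (v + ℓ₁ • α₁ - v) := by
    conv_lhs => rw [← h.coords.repr z, hqz]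
    rw [add_sub_cancel_left, smul_smul, div_mul_cancel₀ _ hℓ₁.ne', zero_smul, add_zero]
  have hze : z ∈ segment ℝ v (v + ℓ₁ • α₁) := by
    rw [hzeq] at hzΔ ⊢
    exact mem_segment_of_isExtreme h.edge_fst.2 hzΔ
  have hxe := h.edge_fst.2.left_mem_of_mem_openSegment hx hy hze ⟨a, b, ha, hb, hab, rfl⟩
  exact hneg.ne (h.snd_eq_zero_of_mem_edge hxe)

lemma fst_nonneg (h : IsChop Δ Δ' v α₁ α₂ δ ℓ₁ ℓ₂ p q) {x : Pt 2} (hx : x ∈ Δ) : 0 ≤ p x :=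
  h.swap.snd_nonneg hx

lemma axis_mem (h : IsChop Δ Δ' v α₁ α₂ δ ℓ₁ ℓ₂ p q) {t : ℝ} (ht : 0 ≤ t) (htl : t ≤ ℓ₁) :
    v + t • α₁ ∈ segment ℝ v (v + ℓ₁ • α₁) := by
  have hℓ₁ : 0 < ℓ₁ := h.pos.trans h.lt_fst
  refine ⟨1 - t / ℓ₁, t / ℓ₁, ?_, by positivity, by ring, ?_⟩
  · rw [sub_nonneg, div_le_one hℓ₁]; exact htl
  · ext i
    simp only [Pi.add_apply, Pi.smul_apply, smul_eq_mul]
    field_simp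
    ring

/-- An edge meeting the chopped corner passes through the vertex. -/
lemma vertex_mem (h : IsChop Δ Δ' v α₁ α₂ δ ℓ₁ ℓ₂ p q) {d : Set (Pt 2)} (hd : IsEdge Δ d)
    {x : Pt 2} (hx : x ∈ d) (hxδ : p x + q x ≤ δ) : v ∈ d := by
  have hxΔ := hd.2.subset hx
  have hp := h.fst_nonneg hxΔ
  have hq := h.snd_nonneg hxΔ
  have hxr := h.coords.repr x
  obtain ⟨m, hm, hm₁, hm₂⟩ : ∃ m, δ < m ∧ m ≤ ℓ₁ ∧ m ≤ ℓ₂ :=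
    ⟨min ℓ₁ ℓ₂, lt_min h.lt_fst h.lt_snd, min_le_left _ _, min_le_right _ _⟩
  have hm0 : 0 < m := h.pos.trans hm
  rcases (add_nonneg hp hq).eq_or_lt with h0 | h0
  · have hp0 : p x = 0 := by linarith
    have hq0 : q x = 0 := by linarith
    rw [hp0, hq0, zero_smul, zero_smul, add_zero, add_zero] at hxr
    rwa [hxr]
  · have h₁ : v + m • α₁ ∈ Δ := h.edge_fst.2.subset (h.axis_mem hm0.le hm₁)
    have h₂ : v + m • α₂ ∈ Δ := h.edge_snd.2.subset (h.swap.axis_mem hm0.le hm₂)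
    have hy := h.convex h₁ h₂ (a := p x / (p x + q x)) (b := q x / (p x + q x))
      (by positivity) (by positivity) (by field_simp)
    have hv : v ∈ Δ := h.edge_fst.2.subset (left_mem_segment ℝ _ _)
    refine hd.2.left_mem_of_mem_openSegment hv hy hx
      ⟨1 - (p x + q x) / m, (p x + q x) / m, ?_, by positivity, by ring, ?_⟩
    · rw [sub_pos, div_lt_one hm0]; linarith
    · conv_rhs => rw [← hxr]
      ext i
      simp only [Pi.add_apply, Pi.smul_apply, smul_eq_mul]
      field_simp
      ring

lemma subset_of_vertex_notMem (h : IsChop Δ Δ' v α₁ α₂ δ ℓ₁ ℓ₂ p q) {d : Set (Pt 2)}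
    (hd : IsEdge Δ d) (hv : v ∉ d) : d ⊆ Δ' := fun x hx =>
  (h.mem_iff x).2 ⟨hd.2.subset hx, le_of_lt (not_le.1 fun hle => hv (h.vertex_mem hd hx hle))⟩

lemma endpoint_mem (h : IsChop Δ Δ' v α₁ α₂ δ ℓ₁ ℓ₂ p q) : v + ℓ₁ • α₁ ∈ Δ' := by
  refine (h.mem_iff _).2 ⟨h.edge_fst.2.subset (right_mem_segment ℝ _ _), ?_⟩
  rw [(h.coords_axis ℓ₁).1, (h.coords_axis ℓ₁).2, add_zero]
  exact h.lt_fst.le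

lemma inter_nonempty (h : IsChop Δ Δ' v α₁ α₂ δ ℓ₁ ℓ₂ p q) {d : Set (Pt 2)}
    (hd : IsEdge Δ d) : (d ∩ Δ').Nonempty := by
  by_cases hv : v ∈ d
  · rcases h.eq_or_eq d hd hv with rfl | rfl
    · exact ⟨_, right_mem_segment ℝ _ _, h.endpoint_mem⟩
    · exact ⟨_, right_mem_segment ℝ _ _, h.swap.endpoint_mem⟩
  · obtain ⟨⟨a, b, -, rfl⟩, -⟩ := id hd
    exact ⟨a, left_mem_segment ℝ a b,
      h.subset_of_vertex_notMem hd hv (left_mem_segment ℝ a b)⟩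

/-- The edge of the chopped polygon with the same outward normal as `d` is `d ∩ Δ'`. -/
lemma eq_inter (h : IsChop Δ Δ' v α₁ α₂ δ ℓ₁ ℓ₂ p q) {d d' : Set (Pt 2)}
    (hd : IsEdge Δ d) (hd' : IsEdge Δ' d') (hn : SameOutwardNormal Δ d Δ' d') :
    d' = d ∩ Δ' := by
  obtain ⟨u, ⟨hu, c, hc, hcΔ⟩, -, c', hc', hcΔ'⟩ := hn
  have hsub : Δ' ⊆ Δ := fun x hx => ((h.mem_iff x).1 hx).1
  obtain ⟨w, hwd, hwΔ'⟩ := h.inter_nonempty hd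
  obtain ⟨y, hy⟩ : d'.Nonempty := by
    obtain ⟨⟨a, b, -, rfl⟩, -⟩ := hd'
    exact ⟨a, left_mem_segment ℝ a b⟩
  obtain rfl : c = c' := le_antisymm ((hc w hwd).symm.trans_le (hcΔ' w hwΔ'))
    ((hc' y hy).symm.trans_le (hcΔ y (hsub (hd'.2.subset hy))))
  ext x
  exact ⟨fun hx => ⟨hd.mem_of_line hu hc (hsub (hd'.2.subset hx)) (hc' x hx), hd'.2.subset hx⟩,
    fun hx => hd'.mem_of_line hu hc' hx.2 (hc x hx.1)⟩

lemma mem_newEdge_iff (h : IsChop Δ Δ' v α₁ α₂ δ ℓ₁ ℓ₂ p q) {x : Pt 2} :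
    x ∈ segment ℝ (v + δ • α₁) (v + δ • α₂) ↔ 0 ≤ p x ∧ 0 ≤ q x ∧ p x + q x = δ := by
  have hδ := h.pos
  constructor
  · rintro ⟨a, b, ha, hb, hab, rfl⟩
    rw [h.coords.fst_comb _ _ _ _ hab, h.coords.snd_comb _ _ _ _ hab, (h.coords_axis δ).1,
      (h.coords_axis δ).2, (h.swap.coords_axis δ).1, (h.swap.coords_axis δ).2]
    refine ⟨by positivity, by positivity, ?_⟩
    linear_combination δ * hab
  · rintro ⟨hp, hq, hpq⟩
    refine ⟨p x / δ, q x / δ, by positivity, by positivity, by rw [← add_div, hpq, div_self hδ.ne'],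
      ?_⟩
    conv_rhs => rw [← h.coords.repr x]
    ext i
    simp only [Pi.add_apply, Pi.smul_apply, smul_eq_mul]
    field_simp
    linear_combination v i * hpq

lemma newEdge_subset (h : IsChop Δ Δ' v α₁ α₂ δ ℓ₁ ℓ₂ p q) :
    segment ℝ (v + δ • α₁) (v + δ • α₂) ⊆ Δ' := fun x hx => by
  refine (h.mem_iff x).2 ⟨h.convex.segment_subset ?_ ?_ hx, (h.mem_newEdge_iff.1 hx).2.2.ge⟩
  · exact h.edge_fst.2.subset (h.axis_mem h.pos.le h.lt_fst.le)
  · exact h.edge_snd.2.subset (h.swap.axis_mem h.pos.le h.lt_snd.le)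

lemma isEdge_newEdge (h : IsChop Δ Δ' v α₁ α₂ δ ℓ₁ ℓ₂ p q) :
    IsEdge Δ' (segment ℝ (v + δ • α₁) (v + δ • α₂)) := by
  refine ⟨⟨_, _, fun heq => ?_, rfl⟩, h.newEdge_subset, ?_⟩
  · have := congrArg p heq
    rw [(h.coords_axis δ).1, (h.swap.coords_axis δ).2] at this
    exact h.pos.ne' this
  · rintro x hx y hy z hz ⟨a, b, ha, hb, hab, rfl⟩
    have hx' := (h.mem_iff x).1 hx
    have hy' := (h.mem_iff y).1 hy
    have hs := (h.mem_newEdge_iff.1 hz).2.2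
    rw [h.coords.fst_comb _ _ _ _ hab, h.coords.snd_comb _ _ _ _ hab] at hs
    refine h.mem_newEdge_iff.2 ⟨h.fst_nonneg hx'.1, h.snd_nonneg hx'.1, hx'.2.antisymm' ?_⟩
    have h1 : b * δ ≤ b * (p y + q y) := mul_le_mul_of_nonneg_left hy'.2 hb.le
    have h2 : a * (p x + q x) ≤ a * δ := by
      have : a * δ + b * δ = δ := by rw [← add_mul, hab, one_mul]
      linarith
    exact le_of_mul_le_mul_left h2 ha

lemma inter_ne_newEdge (h : IsChop Δ Δ' v α₁ α₂ δ ℓ₁ ℓ₂ p q) {d : Set (Pt 2)}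
    (hd : IsEdge Δ d) : d ∩ Δ' ≠ segment ℝ (v + δ • α₁) (v + δ • α₂) := by
  intro heq
  have h₁ : v + δ • α₁ ∈ d := (heq ▸ left_mem_segment ℝ _ _ : _ ∈ d ∩ Δ').1
  have h₂ : v + δ • α₂ ∈ d := (heq ▸ right_mem_segment ℝ _ _ : _ ∈ d ∩ Δ').1
  have hv : v ∈ d := h.vertex_mem hd h₁
    (by rw [(h.coords_axis δ).1, (h.coords_axis δ).2, add_zero])
  rcases h.eq_or_eq d hd hv with rfl | rfl
  · have := h.snd_eq_zero_of_mem_edge h₂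
    rw [(h.swap.coords_axis δ).1] at this
    exact h.pos.ne' this
  · have := h.swap.snd_eq_zero_of_mem_edge h₁
    rw [(h.coords_axis δ).1] at this
    exact h.pos.ne' this

/-- The continuous map pushing the chopped corner onto the new edge. -/
lemma exists_push (h : IsChop Δ Δ' v α₁ α₂ δ ℓ₁ ℓ₂ p q) :
    ∃ ψ : Pt 2 → Pt 2, Continuous ψ ∧ (∀ x ∈ Δ', ψ x = x) ∧
      ∀ x ∈ Δ, x ∉ Δ' → ψ x ∈ segment ℝ (v + δ • α₁) (v + δ • α₂) := by
  refine ⟨fun x => x + (max 0 (δ - (p x + q x)) / 2) • (α₁ + α₂), ?_, ?_, ?_⟩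
  · have := h.coords.fst_cont
    have := h.coords.snd_cont
    fun_prop
  · intro x hx
    have := ((h.mem_iff x).1 hx).2
    simp [max_eq_left (show δ - (p x + q x) ≤ 0 by linarith)]
  · intro x hx hx'
    have hlt : p x + q x < δ := not_le.1 fun hle => hx' ((h.mem_iff x).2 ⟨hx, hle⟩)
    have hp := h.fst_nonneg hx
    have hq := h.snd_nonneg hx
    set r := (δ - (p x + q x)) / 2 with hr
    have heq : x + (max 0 (δ - (p x + q x)) / 2) • (α₁ + α₂) =
        v + (p x + r) • α₁ + (q x + r) • α₂ := by
      rw [max_eq_right (by linarith), ← hr]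
      conv_lhs => rw [← h.coords.repr x]
      module
    beta_reduce
    rw [heq, h.mem_newEdge_iff, h.coords.fst, h.coords.snd]
    refine ⟨?_, ?_, ?_⟩ <;> linarith

end IsChop

/-- `g` is a combination of at most `t + 1` edges of `Δ` with connected union, with
coefficients between `0` and `2 ^ t`. -/
def IsBoundedCombination (Δ : Set (Pt 2)) (t : ℕ) (g : Set (Pt 2) →₀ ℤ) : Prop :=
  ∃ S : Finset (Set (Pt 2)), S.card ≤ t + 1 ∧ (∀ e ∈ S, IsEdge Δ e) ∧
    IsConnected (⋃ e ∈ S, e) ∧ g.support ⊆ S ∧ ∀ e, 0 ≤ g e ∧ g e ≤ 2 ^ t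

open Classical in
lemma IsChop.isBoundedCombination {Δ Δ' : Set (Pt 2)} {v α₁ α₂ : Pt 2} {δ ℓ₁ ℓ₂ : ℝ}
    {p q : Pt 2 → ℝ} (h : IsChop Δ Δ' v α₁ α₂ δ ℓ₁ ℓ₂ p q)
    {f : Set (Pt 2) → (Set (Pt 2) →₀ ℤ)}
    (hf : IsInjectionHom Δ Δ' (segment ℝ (v + δ • α₁) (v + δ • α₂)) v f)
    {t : ℕ} {g : Set (Pt 2) →₀ ℤ} (hg : IsBoundedCombination Δ t g) :
    IsBoundedCombination Δ' (t + 1) (extendF f g) := by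
  obtain ⟨S, hcard, hedge, hconn, hsupp, hbd⟩ := hg
  set N := segment ℝ (v + δ • α₁) (v + δ • α₂)
  have hinter : ∀ d ∈ S, IsEdge Δ' (d ∩ Δ') ∧
      f d = Finsupp.single (d ∩ Δ') 1 + if v ∈ d then Finsupp.single N 1 else 0 := by
    intro d hd
    by_cases hv : v ∈ d
    · obtain ⟨d', hd', hn, hfd⟩ := (hf d (hedge d hd)).2 hv
      obtain rfl := h.eq_inter (hedge d hd) hd' hn
      exact ⟨hd', by rw [hfd, if_pos hv]⟩
    · obtain ⟨d', hd', hn, hfd⟩ := (hf d (hedge d hd)).1 hv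
      obtain rfl := h.eq_inter (hedge d hd) hd' hn
      exact ⟨hd', by rw [hfd, if_neg hv, add_zero]⟩
  have hinj : ∀ d ∈ S, ∀ e ∈ S, d ∩ Δ' = e ∩ Δ' → d = e := by
    intro d hd e he hde
    obtain ⟨⟨a, b, hab, hseg⟩, -⟩ := (hinter d hd).1
    have ha : a ∈ d ∩ Δ' := hseg ▸ left_mem_segment ℝ a b
    have hb : b ∈ d ∩ Δ' := hseg ▸ right_mem_segment ℝ a b
    exact (hedge d hd).eq_of_two_mem (hedge e he) hab ⟨ha.1, (hde ▸ ha).1⟩ ⟨hb.1, (hde ▸ hb).1⟩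
  have happ : ∀ e, extendF f g e =
      ∑ d ∈ S, g d * ((if d ∩ Δ' = e then 1 else 0) + if v ∈ d ∧ N = e then 1 else 0) := by
    intro e
    rw [extendF, Finsupp.sum_of_support_subset g hsupp (fun e m => m • f e) (fun _ _ => zero_smul _ _),
      Finsupp.finsetSum_apply]
    refine Finset.sum_congr rfl fun d hd => ?_
    rw [(hinter d hd).2]
    by_cases hv : v ∈ d <;> simp [hv, Finsupp.single_apply, mul_add]
  refine ⟨S.image (· ∩ Δ') ∪ (if v ∈ ⋃ e ∈ S, e then {N} else ∅), ?_, ?_, ?_, ?_, ?_⟩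
  · refine (Finset.card_union_le _ _).trans (Nat.add_le_add (Finset.card_image_le.trans hcard) ?_)
    split_ifs <;> simp
  · intro e he
    rcases Finset.mem_union.1 he with he | he
    · obtain ⟨d, hd, rfl⟩ := Finset.mem_image.1 he
      exact (hinter d hd).1
    · split_ifs at he
      · rw [Finset.mem_singleton.1 he]
        exact h.isEdge_newEdge
      · simp at he
  · by_cases hv : v ∈ ⋃ e ∈ S, e
    · obtain ⟨ψ, hψ, hfix, hpush⟩ := h.exists_push
      have hvΔ : v ∈ Δ := h.edge_fst.2.subset (left_mem_segment ℝ _ _)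
      have hvΔ' : v ∉ Δ' := fun hmem => by
        have := ((h.mem_iff v).1 hmem).2
        rw [h.coords_vertex.1, h.coords_vertex.2] at this
        linarith [h.pos]
      have hunion : (⋃ e ∈ S.image (· ∩ Δ') ∪ (if v ∈ ⋃ e ∈ S, e then {N} else ∅), e) =
          ψ '' (⋃ e ∈ S, e) ∪ N := by
        rw [if_pos hv]
        ext x
        simp only [Set.mem_iUnion, Finset.mem_union, Finset.mem_image, Finset.mem_singleton,
          exists_prop, Set.mem_union, Set.mem_image]
        constructor
        · rintro ⟨e, ⟨d, hd, rfl⟩ | rfl, hx⟩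
          · exact Or.inl ⟨x, ⟨d, hd, hx.1⟩, hfix x hx.2⟩
          · exact Or.inr hx
        · rintro (⟨y, ⟨d, hd, hy⟩, rfl⟩ | hx)
          · by_cases hyΔ' : y ∈ Δ'
            · exact ⟨d ∩ Δ', Or.inl ⟨d, hd, rfl⟩, by rw [hfix y hyΔ']; exact ⟨hy, hyΔ'⟩⟩
            · exact ⟨N, Or.inr rfl, hpush y ((hedge d hd).2.subset hy) hyΔ'⟩
          · exact ⟨N, Or.inr rfl, hx⟩
      rw [hunion]
      exact IsConnected.union ⟨ψ v, Set.mem_image_of_mem ψ hv, hpush v hvΔ hvΔ'⟩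
        (hconn.image ψ hψ.continuousOn)
        ((convex_segment _ _).isConnected ⟨_, left_mem_segment ℝ _ _⟩)
    · rw [if_neg hv, Finset.union_empty]
      convert hconn using 1
      rw [Finset.set_biUnion_finset_image]
      refine Set.iUnion₂_congr fun d hd => Set.inter_eq_left.2 ?_
      exact h.subset_of_vertex_notMem (hedge d hd) fun hvd => hv (Set.mem_biUnion hd hvd)
  · intro e he
    by_contra hne
    rw [Finsupp.mem_support_iff, happ] at he
    refine he (Finset.sum_eq_zero fun d hd => ?_)
    rw [Finset.mem_union, not_or] at hne
    rw [if_neg fun heq => hne.1 (Finset.mem_image.2 ⟨d, hd, heq⟩), if_neg, add_zero, mul_zero]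
    rintro ⟨hvd, rfl⟩
    refine hne.2 ?_
    rw [if_pos (Set.mem_iUnion₂.2 ⟨d, hd, hvd⟩)]
    exact Finset.mem_singleton_self _
  · intro e
    have hle : (2 : ℤ) ^ t ≤ 2 ^ (t + 1) := pow_le_pow_right₀ (by norm_num) (Nat.le_succ t)
    rw [happ]
    refine ⟨Finset.sum_nonneg fun d _ => mul_nonneg (hbd d).1 (by positivity), ?_⟩
    by_cases heN : N = e
    · calc _ = ∑ d ∈ S, if v ∈ d then g d else 0 := by
            refine Finset.sum_congr rfl fun d hd => ?_
            rw [if_neg (fun heq => h.inter_ne_newEdge (hedge d hd) (heq.trans heN.symm))]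
            by_cases hvd : v ∈ d <;> simp [hvd, heN]
        _ = ∑ d ∈ S with v ∈ d, g d := (Finset.sum_filter _ _).symm
        _ ≤ ∑ d ∈ {segment ℝ v (v + ℓ₁ • α₁), segment ℝ v (v + ℓ₂ • α₂)}, g d := by
            refine Finset.sum_le_sum_of_subset_of_nonneg (fun d hd => ?_) fun d _ _ => (hbd d).1
            rw [Finset.mem_filter] at hd
            simpa using h.eq_or_eq d (hedge d hd.1) hd.2
        _ ≤ Finset.card {segment ℝ v (v + ℓ₁ • α₁), segment ℝ v (v + ℓ₂ • α₂)} • 2 ^ t :=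
            Finset.sum_le_card_nsmul _ _ _ fun d _ => (hbd d).2
        _ ≤ 2 • 2 ^ t := nsmul_le_nsmul_left (by positivity) Finset.card_le_two
        _ = 2 ^ (t + 1) := by rw [pow_succ, two_nsmul, mul_two]
    · simp only [heN, and_false, if_false, add_zero]
      by_cases hex : ∃ d ∈ S, d ∩ Δ' = e
      · obtain ⟨d, hd, rfl⟩ := hex
        rw [Finset.sum_eq_single_of_mem d hd fun b hb hbd => by
          rw [if_neg fun heq => hbd (hinj b hb d hd heq), mul_zero], if_pos rfl, mul_one]
        exact (hbd d).2.trans hle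
      · push Not at hex
        rw [Finset.sum_eq_zero fun d hd => by rw [if_neg (hex d hd), mul_zero]]
        positivity

lemma isBoundedCombination_iterChain {Δ : ℕ → Set (Pt 2)}
    {f : ℕ → Set (Pt 2) → (Set (Pt 2) →₀ ℤ)} {s : ℕ}
    (hstep : ∀ i < s, ∀ t g, IsBoundedCombination (Δ i) t g →
      IsBoundedCombination (Δ (i + 1)) (t + 1) (extendF (f i) g)) (k : ℕ) :
    ∀ j t g, j + k ≤ s → IsBoundedCombination (Δ j) t g →
      IsBoundedCombination (Δ (j + k)) (t + k) (iterChain f j k g) := by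
  induction k with
  | zero => exact fun j t g _ hg => hg
  | succ k ih =>
    intro j t g hjk hg
    have := ih (j + 1) (t + 1) _ (by omega) (hstep j (by omega) t g hg)
    rwa [add_right_comm j, add_right_comm t] at this

/-- Given a sequence of corner choppings `Δ 0 → Δ 1 → ⋯ → Δ s` with associated
injection homomorphisms `f i : ℤ[edges of Δ i] → ℤ[edges of Δ (i+1)]`, the image in
`ℤ[edges of Δ s]` of an edge `d` of `Δ j` is a linear combination `∑ mᵢ • cᵢ` of
distinct edges `c 0, …, c L` of `Δ s` whose union is connected, with `L ≤ s - j` and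
non-negative integer coefficients `mᵢ ≤ 2 ^ (s - j)`. -/
theorem stmt7 (s j : ℕ) (hj : j ≤ s)
    (Δ : ℕ → Set (Pt 2)) (v α₁ α₂ : ℕ → Pt 2) (δ ℓ₁ ℓ₂ : ℕ → ℝ)
    (f : ℕ → Set (Pt 2) → (Set (Pt 2) →₀ ℤ))
    (hΔ : ∀ i ≤ s, IsDelzant (Δ i))
    (hdata : ∀ i < s,
      v i ∈ Set.extremePoints ℝ (Δ i) ∧
      IsLatticeBasis ![α₁ i, α₂ i] ∧
      0 < δ i ∧ δ i < min (ℓ₁ i) (ℓ₂ i) ∧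
      {e | IsEdge (Δ i) e ∧ v i ∈ e} =
        {segment ℝ (v i) (v i + ℓ₁ i • α₁ i), segment ℝ (v i) (v i + ℓ₂ i • α₂ i)} ∧
      Δ (i + 1) =
        Δ i ∩ {x | ∃ s₁ s₂ : ℝ, x = v i + s₁ • α₁ i + s₂ • α₂ i ∧ δ i ≤ s₁ + s₂} ∧
      IsInjectionHom (Δ i) (Δ (i + 1))
        (segment ℝ (v i + δ i • α₁ i) (v i + δ i • α₂ i)) (v i) (f i))
    (d : Set (Pt 2)) (hd : IsEdge (Δ j) d) :
    ∃ L : ℕ, L ≤ s - j ∧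
      ∃ (c : Fin (L + 1) → Set (Pt 2)) (m : Fin (L + 1) → ℕ),
        Function.Injective c ∧
        (∀ i, IsEdge (Δ s) (c i)) ∧
        IsConnected (⋃ i, c i) ∧
        (∀ i, m i ≤ 2 ^ (s - j)) ∧
        iterChain f j (s - j) (Finsupp.single d 1) =
          ∑ i, Finsupp.single (c i) ((m i : ℤ)) := by
  have hchop : ∀ i < s, ∃ p q,
      IsChop (Δ i) (Δ (i + 1)) (v i) (α₁ i) (α₂ i) (δ i) (ℓ₁ i) (ℓ₂ i) p q := by
    intro i hi
    obtain ⟨-, hα, hδ, hδℓ, hedges, hΔ', -⟩ := hdata i hi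
    obtain ⟨p, q, hpq⟩ := exists_isAffineCoords (v i) hα
    have hiff := fun e => Set.ext_iff.1 hedges e
    refine ⟨p, q, hpq, (hΔ i hi.le).1.2.1, hδ, hδℓ.trans_le (min_le_left _ _),
      hδℓ.trans_le (min_le_right _ _), ((hiff _).2 (Or.inl rfl)).1, ((hiff _).2 (Or.inr rfl)).1,
      fun e he hve => (hiff e).1 ⟨he, hve⟩, fun x => ?_⟩
    rw [hΔ']
    refine and_congr_right fun _ => ⟨?_, fun hx => ⟨p x, q x, (hpq.repr x).symm, hx⟩⟩
    rintro ⟨s₁, s₂, rfl, hs⟩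
    rwa [hpq.fst, hpq.snd]
  have hinit : IsBoundedCombination (Δ j) 0 (Finsupp.single d 1) := by
    refine ⟨{d}, by simp, by simpa using hd, ?_, Finsupp.support_single_subset, fun e => ?_⟩
    · obtain ⟨⟨a, b, -, rfl⟩, -⟩ := hd
      simpa using (convex_segment a b).isConnected ⟨a, left_mem_segment ℝ a b⟩
    · classical
      rw [Finsupp.single_apply]
      split_ifs <;> simp
  have hfinal := isBoundedCombination_iterChain (f := f) (fun i hi t g hg => by
    obtain ⟨p, q, hpq⟩ := hchop i hi
    exact hpq.isBoundedCombination (hdata i hi).2.2.2.2.2.2 hg) (s - j) j 0 _ (by omega) hinit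
  rw [Nat.add_sub_cancel' hj, zero_add] at hfinal
  obtain ⟨S, hcard, hedge, hconn, hsupp, hbd⟩ := hfinal
  set g := iterChain f j (s - j) (Finsupp.single d 1)
  have hpos : 0 < S.card := by
    obtain ⟨x, hx⟩ := hconn.nonempty
    obtain ⟨e, he, -⟩ := Set.mem_iUnion₂.1 hx
    exact Finset.card_pos.2 ⟨e, he⟩
  obtain ⟨L, hL⟩ : ∃ L, S.card = L + 1 := ⟨S.card - 1, by omega⟩
  let c := (S.equivFinOfCardEq hL).symm
  refine ⟨L, by omega, fun i => c i, fun i => (g (c i)).toNat,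
    Subtype.val_injective.comp c.injective, fun i => hedge _ (c i).2, ?_, fun i => ?_, ?_⟩
  · convert hconn using 1
    rw [c.surjective.iUnion_comp (fun e : S => (e : Set (Pt 2))), Set.iUnion_subtype]
  · rw [Int.toNat_le]
    exact_mod_cast (hbd _).2
  · simp only [Int.toNat_of_nonneg (hbd _).1]
    rw [c.sum_comp (fun e : S => Finsupp.single (e : Set (Pt 2)) (g e)),
      Finset.sum_coe_sort S (fun e => Finsupp.single e (g e))]
    conv_lhs => rw [← Finsupp.sum_single g]
    exact Finsupp.sum_of_support_subset g hsupp _ fun _ _ => Finsupp.single_zero _
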